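/- arXiv:1211.0842 — 2 statements merged into one kernel-verified Lean document; each statement's English description precedes it below -/
import Mathlib

section
/- Let K be a field, S = K[x_1,…,x_n], let I ⊆ S be the ideal generated by the variable x_1 together with a nonempty set E of squarefree monomials of degree 2 in the variables x_2,…,x_n, and let J ⊂ I be a squarefree monomial ideal generated in degrees ≥ 2. Let B (resp. C) be the set of squarefree monomials of degree 2 (resp. 3) in I \ J, let E' = {a ∈ E : x_1·a ∈ C} and E'' = E \ E'. Assume sdepth_S I/J = 2 and that one of the following holds: (1) |E''| ≤ |C \ ((x_1) ∪ (E'))|, or (2) |E''| > |C \ ((x_1) ∪ (E'))| and |B| ≠ |C| + 1 (here (x_1) and (E') denote the ideals generated by x_1 and by E'). Then depth_S I/J ≤ 2. -/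
open MvPolynomial

/-- The squarefree monomial with support `T` in `K[x_0,…,x_{n-1}]`. -/
noncomputable def sqf (K : Type*) [Field K] (n : ℕ) (T : Finset (Fin n)) :
    MvPolynomial (Fin n) K :=
  ∏ i ∈ T, X i

/-- The poset `P_{I\J}`: supports of squarefree monomials lying in `I \ J`. -/
def sqfPoset (K : Type*) [Field K] (n : ℕ) (I J : Ideal (MvPolynomial (Fin n) K)) :
    Set (Finset (Fin n)) :=
  {T | sqf K n T ∈ I ∧ sqf K n T ∉ J}

/-- Supports of squarefree monomials of degree `d` lying in `I \ J`. -/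
def degSet (K : Type*) [Field K] (n : ℕ) (I J : Ideal (MvPolynomial (Fin n) K)) (d : ℕ) :
    Set (Finset (Fin n)) :=
  {T | T.card = d ∧ T ∈ sqfPoset K n I J}

/-- A partition of a set `P` of supports of squarefree monomials into intervals
`[u,v] = {w : u ⊆ w ⊆ v}`. -/
structure SqfPartition (n : ℕ) (P : Set (Finset (Fin n))) where
  intervals : Finset (Finset (Fin n) × Finset (Fin n))
  le : ∀ p ∈ intervals, p.1 ⊆ p.2
  ends : ∀ p ∈ intervals, p.1 ∈ P ∧ p.2 ∈ P
  covers : ∀ T ∈ P, ∃ p ∈ intervals, p.1 ⊆ T ∧ T ⊆ p.2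
  disj : ∀ p ∈ intervals, ∀ q ∈ intervals, ∀ T : Finset (Fin n),
    p.1 ⊆ T → T ⊆ p.2 → q.1 ⊆ T → T ⊆ q.2 → p = q

/-- The Stanley depth of a partition: the minimal degree of the upper ends of
its intervals. -/
noncomputable def SqfPartition.sdepth {n : ℕ} {P : Set (Finset (Fin n))}
    (pt : SqfPartition n P) : ℕ :=
  sInf {k | ∃ p ∈ pt.intervals, p.2.card = k}

/-- The Stanley depth of `I/J`: the maximal Stanley depth of a partition of `P_{I\J}`. -/
noncomputable def stanleyDepth (K : Type*) [Field K] (n : ℕ)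
    (I J : Ideal (MvPolynomial (Fin n) K)) : ℕ :=
  sSup {k | ∃ pt : SqfPartition n (sqfPoset K n I J), pt.sdepth = k}

/-- The `S`-module `I/J` (for `J ⊆ I` this is the usual quotient). -/
noncomputable abbrev quotMod (K : Type*) [Field K] (n : ℕ)
    (I J : Ideal (MvPolynomial (Fin n) K)) : Type _ :=
  I ⧸ (Submodule.comap I.subtype J)

/-- The depth of `I/J` over `S = K[x_0,…,x_{n-1}]`: the supremum of lengths of
regular sequences on `I/J` consisting of elements of the maximal graded ideal
`(x_0,…,x_{n-1})`. -/
noncomputable def mdepth (K : Type*) [Field K] (n : ℕ)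
    (I J : Ideal (MvPolynomial (Fin n) K)) : ℕ :=
  sSup {k | ∃ rs : List (MvPolynomial (Fin n) K), rs.length = k ∧
    (∀ r ∈ rs, r ∈ Ideal.span (Set.range (X : Fin n → MvPolynomial (Fin n) K))) ∧
    RingTheory.Sequence.IsRegular (quotMod K n I J) rs}

/-- A regular element in the ideal generated by `x` kills zeroth Koszul cohomology. -/
theorem koszul_zero_of_regular {R M ι : Type*} [CommRing R] [AddCommGroup M] [Module R M]
    [Fintype ι] (x : ι → R) {r : R} (hr : r ∈ Ideal.span (Set.range x))
    (hreg : IsSMulRegular M r) (m : M) (hm : ∀ j, x j • m = 0) : m = 0 := by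
  obtain ⟨a, rfl⟩ := (Ideal.mem_span_range_iff_exists_fun).1 hr
  apply hreg
  simp only [smul_zero, Finset.sum_smul, mul_smul, hm, Finset.sum_const_zero]

open Pointwise in
/-- Vanishing of the first Koszul cohomology for a module of depth at least two. -/
theorem koszul_one_of_regular {R M ι : Type*} [CommRing R] [AddCommGroup M] [Module R M]
    [Fintype ι] (x : ι → R) {r s : R} (hr : r ∈ Ideal.span (Set.range x))
    (hs : s ∈ Ideal.span (Set.range x)) (hreg : IsSMulRegular M r)
    (hsreg : IsSMulRegular (QuotSMulTop r M) s) (w : ι → M)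
    (hw : ∀ j k, x j • w k = x k • w j) : ∃ u, ∀ j, w j = x j • u := by
  obtain ⟨a, ha⟩ := (Ideal.mem_span_range_iff_exists_fun).1 hr
  have key : ∀ j, r • w j = x j • ∑ i, a i • w i := by
    intro j
    rw [← ha, Finset.sum_smul, Finset.smul_sum]
    refine Finset.sum_congr rfl fun i _ => ?_
    rw [mul_smul, hw i j, smul_comm]
  have h0 : Submodule.Quotient.mk (p := r • (⊤ : Submodule R M)) (∑ i, a i • w i) = 0 := by
    refine koszul_zero_of_regular x hs hsreg _ fun j => ?_
    rw [← Submodule.Quotient.mk_smul, ← key, Submodule.Quotient.mk_eq_zero]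
    exact Submodule.smul_mem_pointwise_smul _ _ _ trivial
  rw [Submodule.Quotient.mk_eq_zero, Submodule.mem_smul_pointwise_iff_exists] at h0
  obtain ⟨u, -, hu⟩ := h0
  refine ⟨u, fun j => hreg ?_⟩
  simp only
  rw [key, ← hu, smul_comm]

open Pointwise in
/-- Vanishing of the second Koszul cohomology for a module of depth at least three. -/
theorem koszul_two_of_regular {R M ι : Type*} [CommRing R] [AddCommGroup M] [Module R M]
    [Fintype ι] (x : ι → R) {r s t : R} (hr : r ∈ Ideal.span (Set.range x))
    (hs : s ∈ Ideal.span (Set.range x)) (ht : t ∈ Ideal.span (Set.range x))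
    (hreg : IsSMulRegular M r) (hsreg : IsSMulRegular (QuotSMulTop r M) s)
    (htreg : IsSMulRegular (QuotSMulTop s (QuotSMulTop r M)) t) (z : ι → ι → M)
    (hz : ∀ i j k, x i • z j k - x j • z i k + x k • z i j = 0) :
    ∃ v : ι → M, ∀ j k, z j k = x j • v k - x k • v j := by
  obtain ⟨a, ha⟩ := (Ideal.mem_span_range_iff_exists_fun).1 hr
  have key : ∀ j k, r • z j k = x j • (∑ i, a i • z i k) - x k • ∑ i, a i • z i j := by
    intro j k
    rw [← ha, Finset.sum_smul, Finset.smul_sum, Finset.smul_sum, ← Finset.sum_sub_distrib]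
    refine Finset.sum_congr rfl fun i _ => ?_
    have h1 : x i • z j k = x j • z i k - x k • z i j := by
      have := hz i j k
      rw [sub_add, sub_eq_zero] at this
      exact this
    rw [mul_smul, h1, smul_sub, smul_comm (a i), smul_comm (a i)]
  obtain ⟨u, hu⟩ := koszul_one_of_regular x hs ht hsreg htreg
    (fun k => Submodule.Quotient.mk (p := r • (⊤ : Submodule R M)) (∑ i, a i • z i k)) (by
      intro j k
      rw [← sub_eq_zero, ← Submodule.Quotient.mk_smul, ← Submodule.Quotient.mk_smul,
        ← Submodule.Quotient.mk_sub, ← key, Submodule.Quotient.mk_eq_zero]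
      exact Submodule.smul_mem_pointwise_smul _ _ _ trivial)
  obtain ⟨u, rfl⟩ := Submodule.Quotient.mk_surjective _ u
  have hv : ∀ k, ∃ v : M, r • v = (∑ i, a i • z i k) - x k • u := by
    intro k
    have h1 := hu k
    rw [← sub_eq_zero, ← Submodule.Quotient.mk_smul, ← Submodule.Quotient.mk_sub,
      Submodule.Quotient.mk_eq_zero, Submodule.mem_smul_pointwise_iff_exists] at h1
    obtain ⟨v, -, hv⟩ := h1
    exact ⟨v, hv⟩
  choose v hv using hv
  refine ⟨v, fun j k => hreg ?_⟩
  simp only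
  rw [key, smul_sub, smul_comm r, smul_comm r, hv, hv, smul_sub, smul_sub, smul_comm (x j) (x k)]
  abel

/-- A matrix with injective `mulVec` has a nonzero maximal minor. -/
theorem exists_det_submatrix_ne_zero {K m n : Type*} [Field K] [Fintype m] [Fintype n]
    [DecidableEq n] (A : Matrix m n K) (hA : ∀ f, A.mulVec f = 0 → f = 0) :
    ∃ φ : n → m, (A.submatrix φ id).det ≠ 0 := by
  classical
  by_contra! h
  obtain ⟨g, hg⟩ := LinearMap.exists_leftInverse_of_injective (Matrix.toLin' A)
    (LinearMap.ker_eq_bot'.2 fun f hf => hA f (by simpa using hf))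
  have h1 : LinearMap.toMatrix' g * A = 1 := by
    have := congrArg LinearMap.toMatrix' hg
    rwa [LinearMap.toMatrix'_comp, LinearMap.toMatrix'_toLin', LinearMap.toMatrix'_id] at this
  have h2 : (LinearMap.toMatrix' g * A).det = 0 := by
    have h3 : LinearMap.toMatrix' g * A =
        fun b => ∑ c, (LinearMap.toMatrix' g) b c • A c := by
      ext b b'
      simp [Matrix.mul_apply]
    have h4 := (Matrix.detRowAlternating (R := K) (n := n)).toMultilinearMap.map_sum
      (fun b c => (LinearMap.toMatrix' g) b c • A c)
    rw [h3]
    refine h4.trans (Finset.sum_eq_zero fun φ _ => ?_)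
    rw [MultilinearMap.map_smul_univ]
    have : (Matrix.detRowAlternating (R := K) (n := n)).toMultilinearMap (fun i => A (φ i)) = 0 :=
      h φ
    rw [this, smul_zero]
  rw [h1, Matrix.det_one] at h2
  exact one_ne_zero h2

/-- If a matrix `A` has injective `mulVec`, and deleting the entries satisfying `p` makes it
noninjective, then there is a matching of columns into rows along nonzero entries of `A` which
uses an entry satisfying `p`. -/
theorem exists_matching_of_mulVec {K m n : Type*} [Field K] [Fintype m] [Fintype n]
    (A : Matrix m n K) (hA : ∀ f, A.mulVec f = 0 → f = 0) (p : m → n → Prop)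
    (w : n → K) (hw : w ≠ 0)
    (hAw : ∀ c, (∑ b, (open Classical in if p c b then 0 else A c b) * w b) = 0) :
    ∃ μ : n → m, Function.Injective μ ∧ (∀ b, A (μ b) b ≠ 0) ∧ ∃ b, p (μ b) b := by
  classical
  obtain ⟨φ, hφ⟩ := exists_det_submatrix_ne_zero A hA
  have hinj : Function.Injective φ := by
    intro b b' hb
    by_contra hne
    exact hφ (Matrix.det_zero_of_row_eq hne (by ext; simp [hb]))
  set A' : Matrix n n K := fun b b' => if p (φ b) b' then 0 else A (φ b) b' with hA'
  have hdet' : A'.det = 0 := by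
    refine Matrix.exists_mulVec_eq_zero_iff.1 ⟨w, hw, ?_⟩
    ext b
    simpa [Matrix.mulVec, dotProduct, hA'] using hAw (φ b)
  have hne : (A.submatrix φ id).det ≠ A'.det := by rwa [hdet']
  rw [Matrix.det_apply, Matrix.det_apply] at hne
  obtain ⟨σ, hσ⟩ : ∃ σ : Equiv.Perm n, Equiv.Perm.sign σ • ∏ i, (A.submatrix φ id) (σ i) i ≠
      Equiv.Perm.sign σ • ∏ i, A' (σ i) i := by
    by_contra! h
    exact hne (Finset.sum_congr rfl fun σ _ => h σ)
  have hσ' : ∏ i, A (φ (σ i)) i ≠ ∏ i, A' (σ i) i := fun h => hσ (by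
    simp only [Matrix.submatrix_apply, id, h])
  refine ⟨fun b => φ (σ b), hinj.comp σ.injective, fun b hb => hσ' ?_, ?_⟩
  · have hb' : A (φ (σ b)) b = 0 := hb
    have hb'' : A' (σ b) b = 0 := by simp [hA', hb']
    exact (Finset.prod_eq_zero (f := fun i => A (φ (σ i)) i) (Finset.mem_univ b) hb').trans
      (Finset.prod_eq_zero (f := fun i => A' (σ i) i) (Finset.mem_univ b) hb'').symm
  · by_contra! h
    exact hσ' (Finset.prod_congr rfl fun b _ => by simp [hA', h b])

theorem sqf_eq_monomial (K : Type*) [Field K] (n : ℕ) (T : Finset (Fin n)) :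
    sqf K n T = monomial (∑ i ∈ T, Finsupp.single i 1) 1 := by
  rw [sqf, monomial_sum_one]
  rfl

theorem sum_single_le_iff {n : ℕ} (T : Finset (Fin n)) (m : Fin n →₀ ℕ) :
    ∑ i ∈ T, Finsupp.single i 1 ≤ m ↔ T ⊆ m.support := by
  classical
  rw [Finsupp.le_def]
  refine forall_congr' fun i => ?_
  by_cases hi : i ∈ T <;>
    simp [Finsupp.finsetSum_apply, Finsupp.single_apply, hi, Nat.one_le_iff_ne_zero]

theorem support_sum_single {n : ℕ} (T : Finset (Fin n)) :
    (∑ i ∈ T, Finsupp.single i 1 : Fin n →₀ ℕ).support = T := by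
  classical
  ext i
  simp [Finsupp.finsetSum_apply, Finsupp.single_apply]

theorem mem_span_sqf_iff {K : Type*} [Field K] {n : ℕ} {G : Set (Finset (Fin n))}
    {p : MvPolynomial (Fin n) K} :
    p ∈ Ideal.span (sqf K n '' G) ↔ ∀ m ∈ p.support, ∃ g ∈ G, g ⊆ m.support := by
  have : sqf K n '' G = (fun s => monomial s (1 : K)) ''
      ((fun T : Finset (Fin n) => ∑ i ∈ T, Finsupp.single i 1) '' G) := by
    rw [Set.image_image]
    exact Set.image_congr fun T _ => sqf_eq_monomial K n T
  rw [this, mem_ideal_span_monomial_image]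
  simp [sum_single_le_iff]

theorem sqf_mem_span_iff {K : Type*} [Field K] {n : ℕ} {G : Set (Finset (Fin n))}
    {T : Finset (Fin n)} : sqf K n T ∈ Ideal.span (sqf K n '' G) ↔ ∃ g ∈ G, g ⊆ T := by
  classical
  rw [mem_span_sqf_iff, sqf_eq_monomial, support_monomial]
  simp [support_sum_single]

theorem coeff_eq_zero_of_mem_span_sqf {K : Type*} [Field K] {n : ℕ} {G : Set (Finset (Fin n))}
    {p : MvPolynomial (Fin n) K} (hp : p ∈ Ideal.span (sqf K n '' G)) {m : Fin n →₀ ℕ}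
    (hm : sqf K n m.support ∉ Ideal.span (sqf K n '' G)) : coeff m p = 0 := by
  by_contra h
  exact hm (sqf_mem_span_iff.2 (mem_span_sqf_iff.1 hp m (mem_support_iff.2 h)))

theorem sqf_pair {K : Type*} [Field K] {n : ℕ} {j k : Fin n} (h : j ≠ k) :
    sqf K n {j, k} = X j * X k := Finset.prod_pair h

theorem sqf_triple {K : Type*} [Field K] {n : ℕ} {i j k : Fin n} (hij : i ≠ j) (hik : i ≠ k)
    (hjk : j ≠ k) : sqf K n {i, j, k} = X i * (X j * X k) := by
  rw [sqf, Finset.prod_insert (by simp [hij, hik]), Finset.prod_pair hjk]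

/-- The degree two Koszul cocycles of `I/J` with respect to the variables are coboundaries. -/
def KoszulTwoExact {K : Type*} [Field K] {n : ℕ} (I J : Ideal (MvPolynomial (Fin n) K)) : Prop :=
  ∀ z : Fin n → Fin n → MvPolynomial (Fin n) K, (∀ j k, z j k ∈ I) →
    (∀ i j k, X i * z j k - X j * z i k + X k * z i j ∈ J) →
    ∃ v : Fin n → MvPolynomial (Fin n) K, (∀ k, v k ∈ I) ∧
      ∀ j k, z j k - (X j * v k - X k * v j) ∈ J

theorem koszulTwoExact_of_isRegular {K : Type*} [Field K] {n : ℕ}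
    {I J : Ideal (MvPolynomial (Fin n) K)} {rs : List (MvPolynomial (Fin n) K)}
    (hlen : 3 ≤ rs.length)
    (hrs : ∀ r ∈ rs, r ∈ Ideal.span (Set.range (X : Fin n → MvPolynomial (Fin n) K)))
    (hreg : RingTheory.Sequence.IsRegular (quotMod K n I J) rs) : KoszulTwoExact I J := by
  obtain ⟨r, s, t, rs, rfl⟩ : ∃ r s t rs', rs = r :: s :: t :: rs' := by
    match rs, hlen with
    | r :: s :: t :: rs', _ => exact ⟨r, s, t, rs', rfl⟩
  have h := hreg.toIsWeaklyRegular
  rw [RingTheory.Sequence.isWeaklyRegular_cons_iff, RingTheory.Sequence.isWeaklyRegular_cons_iff,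
    RingTheory.Sequence.isWeaklyRegular_cons_iff] at h
  obtain ⟨h1, h2, h3, -⟩ := h
  intro z hzI hz
  obtain ⟨v, hv⟩ := koszul_two_of_regular (X : Fin n → MvPolynomial (Fin n) K)
    (hrs r (by simp)) (hrs s (by simp)) (hrs t (by simp)) h1 h2 h3
    (fun j k => Submodule.Quotient.mk ⟨z j k, hzI j k⟩) (by
      intro i j k
      simp only [← Submodule.Quotient.mk_smul, ← Submodule.Quotient.mk_sub,
        ← Submodule.Quotient.mk_add]
      rw [Submodule.Quotient.mk_eq_zero]
      exact hz i j k)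
  have hv' : ∀ k, ∃ w : I, Submodule.Quotient.mk w = v k :=
    fun k => Submodule.Quotient.mk_surjective _ (v k)
  choose w hw using hv'
  refine ⟨fun k => w k, fun k => (w k).2, fun j k => ?_⟩
  have h4 := hv j k
  rw [← hw, ← hw] at h4
  simp only [← Submodule.Quotient.mk_smul, ← Submodule.Quotient.mk_sub] at h4
  rw [Submodule.Quotient.eq] at h4
  exact h4

/-- If `x₀` is killed in `I/J` by all variables but `x₀` and `xᵢ`, then the second Koszul
cohomology of `I/J` does not vanish. -/
theorem exists_pair_of_koszulTwoExact {K : Type*} [Field K] {n : ℕ} [NeZero n]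
    {A G : Set (Finset (Fin n))} (h0 : {0} ∈ A) (hA : ∅ ∉ A) (hG : ∀ T ∈ G, 2 ≤ T.card)
    (hex : KoszulTwoExact (Ideal.span (sqf K n '' A)) (Ideal.span (sqf K n '' G)))
    {i : Fin n} (hi : i ≠ 0) :
    ∃ j, j ≠ 0 ∧ j ≠ i ∧ sqf K n {0, j} ∉ Ideal.span (sqf K n '' G) := by
  classical
  by_contra! hcon
  set I := Ideal.span (sqf K n '' A) with hI
  set J := Ideal.span (sqf K n '' G) with hJ
  have hX0 : (X 0 : MvPolynomial (Fin n) K) ∈ I := by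
    have : sqf K n {0} ∈ I := sqf_mem_span_iff.2 ⟨_, h0, subset_rfl⟩
    simpa [sqf] using this
  have hXJ : ∀ j, j ≠ 0 → j ≠ i → (X j * X 0 : MvPolynomial (Fin n) K) ∈ J := by
    intro j hj0 hji
    have := hcon j hj0 hji
    rwa [sqf_pair hj0.symm, mul_comm] at this
  let F : Fin n → Fin n → MvPolynomial (Fin n) K := fun j k =>
    if j = 0 ∧ k = i then 1 else if j = i ∧ k = 0 then -1 else 0
  obtain ⟨v, hvI, hv⟩ := hex (fun j k => F j k * X 0) (fun j k => I.mul_mem_left _ hX0) (by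
    have key : ∀ j, j ≠ 0 → j ≠ i → ∀ k, F j k = 0 ∧ F k j = 0 := by
      intro j h1 h2 k
      simp [F, h1, h2]
    intro a b c
    by_cases ha : a ≠ 0 ∧ a ≠ i
    · simp only [(key a ha.1 ha.2 _).1, zero_mul, mul_zero, sub_zero, add_zero]
      rw [mul_left_comm]
      exact J.mul_mem_left _ (hXJ a ha.1 ha.2)
    by_cases hb : b ≠ 0 ∧ b ≠ i
    · simp only [(key b hb.1 hb.2 _).1, (key b hb.1 hb.2 _).2, zero_mul, mul_zero, zero_sub,
        add_zero]
      rw [mul_left_comm]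
      exact J.neg_mem (J.mul_mem_left _ (hXJ b hb.1 hb.2))
    by_cases hc : c ≠ 0 ∧ c ≠ i
    · simp only [(key c hc.1 hc.2 _).2, zero_mul, mul_zero, sub_zero, zero_add]
      rw [mul_left_comm]
      exact J.mul_mem_left _ (hXJ c hc.1 hc.2)
    have h1 : a = 0 ∨ a = i := by tauto
    have h2 : b = 0 ∨ b = i := by tauto
    have h3 : c = 0 ∨ c = i := by tauto
    rcases h1 with rfl | rfl <;> rcases h2 with rfl | rfl <;> rcases h3 with rfl | rfl <;>
      simp [F, hi, hi.symm])
  have h1 := coeff_eq_zero_of_mem_span_sqf (m := Finsupp.single 0 1) (hv 0 i) (by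
    rw [sqf_mem_span_iff, Finsupp.support_single _ one_ne_zero]
    rintro ⟨g, hg, hg0⟩
    have := (hG g hg).trans (Finset.card_le_card hg0)
    simp at this)
  have h2 : coeff 0 (v i) = 0 := by
    refine coeff_eq_zero_of_mem_span_sqf (hvI i) ?_
    rw [sqf_mem_span_iff]
    rintro ⟨g, hg, hg0⟩
    rw [Finsupp.support_zero, Finset.subset_empty] at hg0
    exact hA (hg0 ▸ hg)
  simp [F, coeff_X_mul', hi, h2, coeff_X] at h1

/-- The simplicial coboundary of a cochain `f`, evaluated at `c`. -/
def coboundary {K : Type*} [Field K] {n : ℕ} (f : Finset (Fin n) → K) (c : Finset (Fin n)) : K :=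
  ∑ t ∈ c, (-1) ^ (c.filter (· < t)).card * f (c.erase t)

theorem coboundary_triple {K : Type*} [Field K] {n : ℕ} (f : Finset (Fin n) → K)
    {p q r : Fin n} (hpq : p < q) (hqr : q < r) :
    coboundary f {p, q, r} = f {q, r} - f {p, r} + f {p, q} := by
  have hpr := hpq.trans hqr
  have e1 : ({p, q, r} : Finset (Fin n)).erase p = {q, r} := by
    ext x; simp only [Finset.mem_erase, Finset.mem_insert, Finset.mem_singleton]; grind
  have e2 : ({p, q, r} : Finset (Fin n)).erase q = {p, r} := by
    ext x; simp only [Finset.mem_erase, Finset.mem_insert, Finset.mem_singleton]; grind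
  have e3 : ({p, q, r} : Finset (Fin n)).erase r = {p, q} := by
    ext x; simp only [Finset.mem_erase, Finset.mem_insert, Finset.mem_singleton]; grind
  rw [coboundary, Finset.sum_insert (by simp [hpq.ne, hpr.ne]), Finset.sum_pair hqr.ne, e1, e2, e3]
  simp [Finset.filter_insert, Finset.filter_singleton, hpq, hqr, hpr, hpq.not_gt, hqr.not_gt,
    hpr.not_gt, hpq.ne]
  ring

/-- The ordered version of a cochain on two-element sets. -/
def orderedCochain {K : Type*} [Field K] {n : ℕ} (f : Finset (Fin n) → K) (j k : Fin n) : K :=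
  if j < k then f {j, k} else if k < j then -f {j, k} else 0

theorem orderedCochain_self {K : Type*} [Field K] {n : ℕ} (f : Finset (Fin n) → K) (j : Fin n) :
    orderedCochain f j j = 0 := by
  simp [orderedCochain]

theorem orderedCochain_swap {K : Type*} [Field K] {n : ℕ} (f : Finset (Fin n) → K)
    (j k : Fin n) : orderedCochain f k j = -orderedCochain f j k := by
  rcases lt_trichotomy j k with h | rfl | h
  · simp [orderedCochain, h, h.not_gt, Finset.pair_comm k j]
  · simp [orderedCochain]
  · simp [orderedCochain, h, h.not_gt, Finset.pair_comm k j]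

theorem orderedCochain_of_lt {K : Type*} [Field K] {n : ℕ} (f : Finset (Fin n) → K)
    {j k : Fin n} (h : j < k) : orderedCochain f j k = f {j, k} := by
  simp [orderedCochain, h]

theorem orderedCochain_triple {K : Type*} [Field K] {n : ℕ} (f : Finset (Fin n) → K)
    {i j k : Fin n} (hij : i ≠ j) (hik : i ≠ k) (hjk : j ≠ k)
    (h : coboundary f {i, j, k} = 0) :
    orderedCochain f j k - orderedCochain f i k + orderedCochain f i j = 0 := by
  have key : ∀ p q r : Fin n, p < q → q < r → coboundary f {p, q, r} = 0 →
      orderedCochain f q r - orderedCochain f p r + orderedCochain f p q = 0 := by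
    intro p q r hpq hqr h
    rwa [orderedCochain_of_lt f hpq, orderedCochain_of_lt f hqr,
      orderedCochain_of_lt f (hpq.trans hqr), ← coboundary_triple f hpq hqr]
  have s1 := orderedCochain_swap f i j
  have s2 := orderedCochain_swap f i k
  have s3 := orderedCochain_swap f j k
  have perm : ∀ p q r : Fin n, ({p, q, r} : Finset (Fin n)) = {i, j, k} → p < q → q < r →
      orderedCochain f q r - orderedCochain f p r + orderedCochain f p q = 0 :=
    fun p q r he hpq hqr => key p q r hpq hqr (he ▸ h)
  rcases lt_or_gt_of_ne hij with h1 | h1 <;> rcases lt_or_gt_of_ne hik with h2 | h2 <;>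
    rcases lt_or_gt_of_ne hjk with h3 | h3
  · exact perm i j k rfl h1 h3
  · have := perm i k j (by grind) h2 h3
    linear_combination -this + s3
  · exact absurd (h1.trans h3) h2.not_gt
  · have := perm k i j (by grind) h2 h1
    linear_combination this + s3 - s2
  · have := perm j i k (by grind) h1 h2
    linear_combination -this + s1
  · exact absurd (h1.trans h2) h3.not_gt
  · have := perm j k i (by grind) h3 h2
    linear_combination this - s2 + s1
  · have := perm k j i (by grind) h3 h1
    linear_combination -this + s1 - s2 + s3

/-- The kernel of the coboundary map on degree two is spanned by the image of `x₀`. -/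
theorem cocycle_of_koszulTwoExact {K : Type*} [Field K] {n : ℕ} [NeZero n]
    {A G : Set (Finset (Fin n))} (hA : ∀ T ∈ A, T = {0} ∨ T.card = 2)
    (hex : KoszulTwoExact (Ideal.span (sqf K n '' A)) (Ideal.span (sqf K n '' G)))
    {B C : Set (Finset (Fin n))}
    (hB : B = degSet K n (Ideal.span (sqf K n '' A)) (Ideal.span (sqf K n '' G)) 2)
    (hC : C = degSet K n (Ideal.span (sqf K n '' A)) (Ideal.span (sqf K n '' G)) 3)
    (f : Finset (Fin n) → K) (hf : ∀ T ∉ B, f T = 0) (hcob : ∀ c ∈ C, coboundary f c = 0) :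
    ∃ a : K, ∀ b ∈ B, f b = if 0 ∈ b then a else 0 := by
  classical
  subst hB hC
  set I := Ideal.span (sqf K n '' A) with hI
  set J := Ideal.span (sqf K n '' G) with hJ
  have hFB : ∀ j k, orderedCochain f j k ≠ 0 → j ≠ k ∧ sqf K n {j, k} ∈ I := by
    intro j k h
    have hjk : j ≠ k := by
      rintro rfl
      exact h (orderedCochain_self f j)
    refine ⟨hjk, ?_⟩
    by_contra hn
    have : f {j, k} = 0 := hf _ fun hm => hn hm.2.1
    exact h (by simp [orderedCochain, this])
  obtain ⟨v, hvI, hv⟩ := hex (fun j k => C (orderedCochain f j k) * (X j * X k)) (by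
    intro j k
    by_cases h : orderedCochain f j k = 0
    · simp [h]
    · obtain ⟨h1, h2⟩ := hFB j k h
      rw [sqf_pair h1] at h2
      exact I.mul_mem_left _ h2) (by
    intro i j k
    have e : X i * (C (orderedCochain f j k) * (X j * X k)) -
        X j * (C (orderedCochain f i k) * (X i * X k)) +
        X k * (C (orderedCochain f i j) * (X i * X j)) =
        C (orderedCochain f j k - orderedCochain f i k + orderedCochain f i j) *
          (X i * (X j * X k) : MvPolynomial (Fin n) K) := by
      simp only [C_add, C_sub]
      ring
    rw [e]
    by_cases hz : orderedCochain f j k - orderedCochain f i k + orderedCochain f i j = 0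
    · simp [hz]
    have hij : i ≠ j := by
      rintro rfl
      exact hz (by simp [orderedCochain_self])
    have hjk : j ≠ k := by
      rintro rfl
      exact hz (by simp [orderedCochain_self])
    have hik : i ≠ k := by
      rintro rfl
      exact hz (by rw [orderedCochain_self, orderedCochain_swap f i j]; ring)
    refine J.mul_mem_left _ ?_
    rw [← sqf_triple hij hik hjk]
    by_contra hnJ
    have hnI : sqf K n {i, j, k} ∉ I := by
      intro hmI
      refine hz (orderedCochain_triple f hij hik hjk (hcob _ ⟨?_, hmI, hnJ⟩))
      exact Finset.card_eq_three.2 ⟨i, j, k, hij, hik, hjk, rfl⟩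
    have hup : ∀ p q, ({p, q} : Finset (Fin n)) ⊆ {i, j, k} → orderedCochain f p q = 0 := by
      intro p q hpq
      by_contra h
      obtain ⟨g, hg, hgs⟩ := sqf_mem_span_iff.1 (hFB p q h).2
      exact hnI (sqf_mem_span_iff.2 ⟨g, hg, hgs.trans hpq⟩)
    apply hz
    rw [hup j k (by grind), hup i k (by grind), hup i j (by grind)]
    ring)
  have hlin : ∀ k, k ≠ 0 → coeff (Finsupp.single k 1) (v k) = 0 := by
    intro k hk
    refine coeff_eq_zero_of_mem_span_sqf (hvI k) ?_
    rw [sqf_mem_span_iff, Finsupp.support_single _ one_ne_zero]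
    rintro ⟨g, hg, hgk⟩
    rcases hA g hg with rfl | h
    · simp at hgk
      exact hk hgk.symm
    · have := Finset.card_le_card hgk
      simp [h] at this
  refine ⟨-coeff (Finsupp.single 0 1) (v 0), ?_⟩
  intro b hb
  obtain ⟨j, k, hjk, rfl⟩ : ∃ j k, j < k ∧ b = {j, k} := by
    obtain ⟨j, k, hne, rfl⟩ := Finset.card_eq_two.1 hb.1
    rcases lt_or_gt_of_ne hne with h | h
    · exact ⟨j, k, h, rfl⟩
    · exact ⟨k, j, h, Finset.pair_comm _ _⟩
  have hsupp : (Finsupp.single j 1 + Finsupp.single k 1 : Fin n →₀ ℕ).support = {j, k} := by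
    rw [← support_sum_single ({j, k} : Finset (Fin n)), Finset.sum_pair hjk.ne]
  have hc := coeff_eq_zero_of_mem_span_sqf (m := Finsupp.single j 1 + Finsupp.single k 1) (hv j k)
    (by rw [hsupp]; exact hb.2.2)
  have hk0 : k ≠ 0 := fun h => by simp [h] at hjk
  have e1 : coeff (Finsupp.single j 1 + Finsupp.single k 1) (X j * v k) = 0 := by
    rw [coeff_X_mul, hlin k hk0]
  have e2 : coeff (Finsupp.single j 1 + Finsupp.single k 1) (X k * v j) =
      coeff (Finsupp.single j 1) (v j) := by
    rw [add_comm, coeff_X_mul]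
  have e3 : coeff (Finsupp.single j 1 + Finsupp.single k 1)
      (X j * X k : MvPolynomial (Fin n) K) = 1 := by
    rw [coeff_X_mul, coeff_X]
    simp
  simp only [coeff_sub, coeff_C_mul, e1, e2, e3, orderedCochain_of_lt f hjk] at hc
  by_cases hj : j = 0
  · subst hj
    simp only [Finset.mem_insert, true_or, if_true]
    linear_combination hc
  · rw [hlin j hj] at hc
    rw [if_neg (by simp [Ne.symm hj, hk0.symm])]
    linear_combination hc

theorem sum_coboundary_single {K : Type*} [Field K] {n : ℕ} (s : Set (Finset (Fin n)))
    [Fintype s] (f : s → K) (c : Finset (Fin n)) :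
    ∑ b : s, coboundary (Pi.single (b : Finset (Fin n)) (1 : K)) c * f b =
      coboundary (Function.extend Subtype.val f 0) c := by
  classical
  simp only [coboundary, Finset.sum_mul]
  rw [Finset.sum_comm]
  refine Finset.sum_congr rfl fun t _ => ?_
  by_cases h : c.erase t ∈ s
  · have e : Function.extend Subtype.val f 0 (c.erase t) = f ⟨c.erase t, h⟩ :=
      Subtype.val_injective.extend_apply f 0 ⟨c.erase t, h⟩
    rw [e, Finset.sum_eq_single ⟨c.erase t, h⟩]
    · simp
    · intro b _ hb
      have : c.erase t ≠ b := fun h' => hb (Subtype.ext h'.symm)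
      simp [this]
    · simp
  · rw [Function.extend_apply' _ _ _ (by rintro ⟨a, ha⟩; exact h (ha ▸ a.2)), Pi.zero_apply,
      mul_zero]
    refine Finset.sum_eq_zero fun b _ => ?_
    have : c.erase t ≠ b := fun h' => h (h' ▸ b.2)
    simp [this]

theorem exists_erase_eq_of_coboundary_single_ne_zero {K : Type*} [Field K] {n : ℕ}
    {b c : Finset (Fin n)} (h : coboundary (Pi.single b (1 : K)) c ≠ 0) :
    ∃ t ∈ c, c.erase t = b := by
  classical
  obtain ⟨t, ht, h1⟩ := Finset.exists_ne_zero_of_sum_ne_zero h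
  refine ⟨t, ht, ?_⟩
  by_contra hne
  exact h1 (by simp [hne])

/-- If the coboundary map on two-element sets has kernel spanned by the indicator of the sets
containing `0`, then all two-element sets but `{0, i}` can be matched to three-element sets in
such a way that some `{0, j}` is matched to `{0, i, j}`. -/
theorem exists_matching_of_cocycle {K : Type*} [Field K] {n : ℕ} [NeZero n]
    {B C : Set (Finset (Fin n))} (hB : ∀ b ∈ B, b.card = 2) (hC : ∀ c ∈ C, c.card = 3)
    (hCB : ∀ c ∈ C, 0 ∈ c → ∀ q ∈ c, q ≠ 0 → {0, q} ∈ B)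
    (hcoc : ∀ f : Finset (Fin n) → K, (∀ T ∉ B, f T = 0) → (∀ c ∈ C, coboundary f c = 0) →
      ∃ a : K, ∀ b ∈ B, f b = if 0 ∈ b then a else 0)
    {i k : Fin n} (hi : {0, i} ∈ B) (hk : {0, k} ∈ B) (hki : k ≠ i) (hk0 : k ≠ 0) :
    ∃ (j : Fin n) (μ : Finset (Fin n) → Finset (Fin n)), {0, j} ∈ B ∧ j ≠ i ∧
      μ {0, j} = {0, i, j} ∧ Set.InjOn μ (B \ {{0, i}}) ∧
      ∀ b ∈ B \ {{0, i}}, μ b ∈ C ∧ b ⊆ μ b := by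
  classical
  have hi0 : i ≠ 0 := by
    rintro rfl
    have := hB _ hi
    simp at this
  let s : Set (Finset (Fin n)) := B \ {{0, i}}
  have : Fintype s := Fintype.ofFinite _
  have : Fintype C := Fintype.ofFinite _
  let A : Matrix C s K := fun c b => coboundary (Pi.single (b : Finset (Fin n)) 1) c
  have hext : ∀ (f : s → K) (b : s), Function.extend Subtype.val f 0 (b : Finset (Fin n)) = f b :=
    fun f b => Subtype.val_injective.extend_apply f 0 b
  have hext0 : ∀ (f : s → K) (T : Finset (Fin n)), T ∉ s →
      Function.extend Subtype.val f 0 T = 0 := by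
    intro f T hT
    rw [Function.extend_apply' _ _ _ (by rintro ⟨a, rfl⟩; exact hT a.2), Pi.zero_apply]
  have hinj : ∀ f, A.mulVec f = 0 → f = 0 := by
    intro f hf
    obtain ⟨a, ha⟩ := hcoc (Function.extend Subtype.val f 0)
      (fun T hT => hext0 f T fun h => hT h.1) (fun c hc => by
        rw [← sum_coboundary_single]
        exact congrFun hf ⟨c, hc⟩)
    have ha0 : a = 0 := by
      have := ha _ hi
      rw [hext0 f _ (by simp [s])] at this
      simpa using this.symm
    ext b
    rw [← hext f b, ha _ b.2.1, ha0]
    simp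
  have hks : {0, k} ∈ s := by
    refine ⟨hk, fun h => ?_⟩
    have h1 : k ∈ ({0, i} : Finset (Fin n)) := h ▸ by simp
    simp [hki, hk0] at h1
  obtain ⟨μ, hμinj, hμ, b, hb, hb0⟩ := exists_matching_of_mulVec A hinj
    (fun c b => i ∈ c.1 ∧ 0 ∈ b.1) (fun b => if 0 ∈ b.1 then 1 else 0)
    (fun h => by simpa using congrFun h ⟨_, hks⟩) (by
      intro c
      by_cases hic : i ∈ c.1
      · refine Finset.sum_eq_zero fun b _ => ?_
        by_cases h : 0 ∈ b.1 <;> simp [hic, h]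
      simp only [hic, false_and, if_false]
      refine (sum_coboundary_single s _ c.1).trans ?_
      set w : s → K := fun b => if 0 ∈ b.1 then 1 else 0 with hw
      have hw0 : ∀ T : Finset (Fin n), 0 ∉ T → Function.extend Subtype.val w 0 T = 0 := by
        intro T hT
        by_cases h : T ∈ s
        · rw [hext w ⟨T, h⟩]
          simp [hw, hT]
        · exact hext0 w T h
      by_cases h0 : 0 ∈ c.1
      · obtain ⟨q, r, hqr, hqr'⟩ := Finset.card_eq_two.1
          (show (c.1.erase 0).card = 2 by rw [Finset.card_erase_of_mem h0, hC _ c.2])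
        obtain ⟨q, r, hqr, hce⟩ : ∃ q r, q < r ∧ c.1.erase 0 = {q, r} := by
          rcases lt_or_gt_of_ne hqr with h | h
          · exact ⟨q, r, h, hqr'⟩
          · exact ⟨r, q, h, hqr'.trans (Finset.pair_comm _ _)⟩
        have hq : q ∈ c.1.erase 0 := by simp [hce]
        have hr : r ∈ c.1.erase 0 := by simp [hce]
        have hc : c.1 = {0, q, r} := by rw [← Finset.insert_erase h0, hce]
        have hval : ∀ x ∈ c.1.erase 0, Function.extend Subtype.val w 0 {0, x} = 1 := by
          intro x hx
          rw [Finset.mem_erase] at hx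
          have hxs : {0, x} ∈ s := by
            refine ⟨hCB _ c.2 h0 x hx.2 hx.1, fun h => ?_⟩
            have h1 : x ∈ ({0, i} : Finset (Fin n)) := h ▸ by simp
            simp only [Finset.mem_insert, hx.1, Finset.mem_singleton, false_or] at h1
            exact hic (h1 ▸ hx.2)
          rw [hext w ⟨_, hxs⟩]
          simp [hw]
        rw [hc, coboundary_triple _ (Fin.pos_iff_ne_zero.2 (Finset.ne_of_mem_erase hq)) hqr,
          hval q hq, hval r hr, hw0]
        · ring
        · rw [← hce]
          simp
      · refine Finset.sum_eq_zero fun t _ => ?_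
        rw [hw0 _ fun h => h0 (Finset.mem_of_mem_erase h), mul_zero])
  have hsub : ∀ b : s, b.1 ⊆ (μ b).1 := by
    intro b
    obtain ⟨t, -, ht⟩ := exists_erase_eq_of_coboundary_single_ne_zero (hμ b)
    exact ht ▸ Finset.erase_subset _ _
  have hμe : ∀ b (hb : b ∈ s), Function.extend Subtype.val (fun b : s => (μ b).1) id b =
      (μ ⟨b, hb⟩).1 := fun b hb => Subtype.val_injective.extend_apply _ _ ⟨b, hb⟩
  obtain ⟨j, hj⟩ := Finset.card_eq_one.1
    (show (b.1.erase 0).card = 1 by rw [Finset.card_erase_of_mem hb0, hB _ b.2.1])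
  have hbj : b.1 = {0, j} := by rw [← Finset.insert_erase hb0, hj]
  have hji : j ≠ i := by
    rintro rfl
    exact b.2.2 hbj
  have hj0 : j ≠ 0 := Finset.ne_of_mem_erase (hj ▸ Finset.mem_singleton_self j)
  refine ⟨j, Function.extend Subtype.val (fun b : s => (μ b).1) id, hbj ▸ b.2.1, hji, ?_, ?_, ?_⟩
  · rw [← hbj, hμe _ b.2]
    symm
    refine Finset.eq_of_subset_of_card_le ?_ ?_
    · have := hsub b
      rw [hbj] at this
      intro x hx
      simp only [Finset.mem_insert, Finset.mem_singleton] at hx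
      rcases hx with rfl | rfl | rfl
      · exact this (by simp)
      · exact hb
      · exact this (by simp)
    · rw [hC _ (μ b).2, Finset.card_eq_three.2 ⟨0, i, j, hi0.symm, hj0.symm, hji.symm, rfl⟩]
  · intro b hb b' hb' h
    rw [hμe b hb, hμe b' hb'] at h
    exact congrArg Subtype.val (hμinj (Subtype.ext h))
  · intro b hb
    rw [hμe b hb]
    exact ⟨(μ ⟨b, hb⟩).2, hsub ⟨b, hb⟩⟩

theorem eq_or_eq_of_subset_of_card_succ {α : Type*} {b T c : Finset α} (hbT : b ⊆ T)
    (hTc : T ⊆ c) (h : c.card = b.card + 1) : T = b ∨ T = c := by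
  have h1 := Finset.card_le_card hbT
  have h2 := Finset.card_le_card hTc
  rcases Nat.lt_or_ge b.card T.card with h3 | h3
  · exact Or.inr (Finset.eq_of_subset_of_card_le hTc (by omega))
  · exact Or.inl (Finset.eq_of_subset_of_card_le hbT h3).symm

theorem eq_of_singleton_subset_of_subset_triple {α : Type*} [DecidableEq α] {a i j : α}
    {T : Finset α} (h1 : {a} ⊆ T) (h2 : T ⊆ {a, i, j}) :
    T = {a} ∨ T = {a, i} ∨ T = {a, j} ∨ T = {a, i, j} := by
  have ha : a ∈ T := h1 (by simp)
  have h (x) (hx : x ∈ T) : x = a ∨ x = i ∨ x = j := by simpa using h2 hx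
  by_cases hi : i ∈ T <;> by_cases hj : j ∈ T
  · right; right; right
    ext x
    simp only [Finset.mem_insert, Finset.mem_singleton]
    grind
  · right; left
    ext x
    simp only [Finset.mem_insert, Finset.mem_singleton]
    grind
  · right; right; left
    ext x
    simp only [Finset.mem_insert, Finset.mem_singleton]
    grind
  · left
    ext x
    simp only [Finset.mem_singleton]
    grind

/-- A matching as in `exists_matching_of_cocycle` produces a partition of Stanley depth at least
three. -/
theorem exists_sqfPartition_of_matching {n : ℕ} [NeZero n] {P B C : Set (Finset (Fin n))}
    (hP : ∀ T ∈ P, T = {0} ∨ 2 ≤ T.card) (hP0 : {0} ∈ P)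
    (hB : ∀ T, T ∈ B ↔ T.card = 2 ∧ T ∈ P) (hC : ∀ T, T ∈ C ↔ T.card = 3 ∧ T ∈ P)
    {i j : Fin n} (hi : {0, i} ∈ B) (hj : {0, j} ∈ B) (hji : j ≠ i)
    {μ : Finset (Fin n) → Finset (Fin n)} (hμj : μ {0, j} = {0, i, j})
    (hinj : Set.InjOn μ (B \ {{0, i}})) (hμ : ∀ b ∈ B \ {{0, i}}, μ b ∈ C ∧ b ⊆ μ b) :
    ∃ pt : SqfPartition n P, 3 ≤ pt.sdepth := by
  classical
  have hi0 : i ≠ 0 := by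
    rintro rfl
    have := ((hB _).1 hi).1
    simp at this
  have hj0 : j ≠ 0 := by
    rintro rfl
    have := ((hB _).1 hj).1
    simp at this
  have hjs : {0, j} ∈ B \ {{0, i}} := by
    refine ⟨hj, fun h => ?_⟩
    have h1 : j ∈ ({0, i} : Finset (Fin n)) := h ▸ by simp
    simp [hji, hj0] at h1
  have hcC : {0, i, j} ∈ C := hμj ▸ (hμ _ hjs).1
  have hbetween : ∀ b ∈ B \ {{0, i}}, ∀ T, b ⊆ T → T ⊆ μ b → T = b ∨ T = μ b := by
    intro b hb T h1 h2
    exact eq_or_eq_of_subset_of_card_succ h1 h2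
      (by rw [((hC _).1 (hμ b hb).1).1, ((hB _).1 hb.1).1])
  have hroot : ∀ T : Finset (Fin n), {0} ⊆ T → T ⊆ {0, i, j} →
      T = {0} ∨ T = {0, i} ∨ T = {0, j} ∨ T = μ {0, j} := by
    intro T h1 h2
    rw [hμj]
    exact eq_of_singleton_subset_of_subset_triple h1 h2
  let S : Set (Finset (Fin n) × Finset (Fin n)) := {p | p = ({0}, {0, i, j}) ∨
    (p.1 ∈ B \ {{0, i}} ∧ p.1 ≠ {0, j} ∧ p.2 = μ p.1) ∨
    (p.2 = p.1 ∧ p.1 ∈ P ∧ 3 ≤ p.1.card ∧ ∀ b ∈ B \ {{0, i}}, p.1 ≠ μ b)}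
  have hS : ∀ p, p ∈ S.toFinite.toFinset ↔ p = ({0}, {0, i, j}) ∨
    (p.1 ∈ B \ {{0, i}} ∧ p.1 ≠ {0, j} ∧ p.2 = μ p.1) ∨
    (p.2 = p.1 ∧ p.1 ∈ P ∧ 3 ≤ p.1.card ∧ ∀ b ∈ B \ {{0, i}}, p.1 ≠ μ b) := by
    intro p
    rw [Set.Finite.mem_toFinset]
    rfl
  have hcov : ∀ T ∈ P, ∃ p ∈ S.toFinite.toFinset, p.1 ⊆ T ∧ T ⊆ p.2 := by
    intro T hT
    simp only [hS]
    by_cases h1 : {0} ⊆ T ∧ T ⊆ {0, i, j}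
    · exact ⟨_, Or.inl rfl, h1⟩
    have hTi : T ≠ {0, i} := fun h => h1 (by subst h; simp [Finset.insert_subset_iff])
    have hTj : T ≠ {0, j} := fun h => h1 (by subst h; simp [Finset.insert_subset_iff])
    have hT0 : T ≠ {0} := fun h => h1 (by subst h; simp)
    have hT2 := (hP T hT).resolve_left hT0
    rcases hT2.eq_or_lt with h2 | h2
    · have hTB : T ∈ B \ {{0, i}} := ⟨(hB T).2 ⟨h2.symm, hT⟩, hTi⟩
      exact ⟨(T, μ T), Or.inr (Or.inl ⟨hTB, hTj, rfl⟩), subset_rfl, (hμ T hTB).2⟩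
    by_cases h3 : ∀ b ∈ B \ {{0, i}}, T ≠ μ b
    · exact ⟨(T, T), Or.inr (Or.inr ⟨rfl, hT, h2, h3⟩), subset_rfl, subset_rfl⟩
    push Not at h3
    obtain ⟨b, hb, rfl⟩ := h3
    have hbj : b ≠ {0, j} := by
      rintro rfl
      rw [hμj] at h1
      exact h1 ⟨by simp, subset_rfl⟩
    exact ⟨(b, μ b), Or.inr (Or.inl ⟨hb, hbj, rfl⟩), (hμ b hb).2, subset_rfl⟩
  have hcardB : ∀ b ∈ B \ {{0, i}}, b.card = 2 := fun b hb => ((hB b).1 hb.1).1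
  have hcardC : ∀ b ∈ B \ {{0, i}}, (μ b).card = 3 := fun b hb => ((hC _).1 (hμ b hb).1).1
  have hrootmatch : ∀ b ∈ B \ {{0, i}}, b ≠ {0, j} → ∀ T, {0} ⊆ T → T ⊆ {0, i, j} → b ⊆ T →
      T ⊆ μ b → False := by
    intro b hb hbj T h1 h2 h3 h4
    have hb2 := hcardB b hb
    have hb3 := hcardC b hb
    have hj3 := hcardC _ hjs
    have hj2 := hcardB _ hjs
    have hi2 := ((hB _).1 hi).1
    rcases hbetween b hb T h3 h4 with rfl | rfl
    · rcases hroot T h1 h2 with rfl | rfl | rfl | rfl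
      · simp at hb2
      · exact hb.2 rfl
      · exact hbj rfl
      · omega
    · rcases hroot _ h1 h2 with h | h | h | h
      · rw [h] at hb3
        simp at hb3
      · rw [h] at hb3
        omega
      · rw [h] at hb3
        omega
      · exact hbj (hinj hb hjs h)
  have hrootsing : ∀ T : Finset (Fin n), {0} ⊆ T → T ⊆ {0, i, j} → 3 ≤ T.card →
      (∀ b ∈ B \ {{0, i}}, T ≠ μ b) → False := by
    intro T h1 h2 h3 h4
    have hj2 := hcardB _ hjs
    have hi2 := ((hB _).1 hi).1
    rcases hroot T h1 h2 with rfl | rfl | rfl | rfl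
    · simp at h3
    · omega
    · omega
    · exact h4 _ hjs rfl
  have hmatchsing : ∀ b ∈ B \ {{0, i}}, ∀ T, b ⊆ T → T ⊆ μ b → 3 ≤ T.card →
      (∀ b ∈ B \ {{0, i}}, T ≠ μ b) → False := by
    intro b hb T h1 h2 h3 h4
    have hb2 := hcardB b hb
    rcases hbetween b hb T h1 h2 with rfl | rfl
    · omega
    · exact h4 b hb rfl
  have hle : ∀ p ∈ S.toFinite.toFinset, p.1 ⊆ p.2 := by
    intro p hp
    rcases (hS p).1 hp with rfl | ⟨h1, -, h2⟩ | ⟨h1, -⟩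
    · simp
    · exact h2 ▸ (hμ _ h1).2
    · exact h1 ▸ subset_rfl
  let pt : SqfPartition n P :=
    { intervals := S.toFinite.toFinset
      le := hle
      ends := by
        intro p hp
        rcases (hS p).1 hp with rfl | ⟨h1, -, h2⟩ | ⟨h1, h2, -⟩
        · exact ⟨hP0, ((hC _).1 hcC).2⟩
        · exact ⟨((hB _).1 h1.1).2, h2 ▸ ((hC _).1 (hμ _ h1).1).2⟩
        · exact ⟨h2, h1 ▸ h2⟩
      covers := hcov
      disj := by
        rintro ⟨u, v⟩ hp ⟨u', v'⟩ hq T h1 h2 h3 h4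
        rw [hS] at hp hq
        simp only [Prod.mk.injEq] at hp hq h1 h2 h3 h4 ⊢
        rcases hp with ⟨rfl, rfl⟩ | ⟨hb, hbj, rfl⟩ | ⟨rfl, -, hc, hn⟩ <;>
          rcases hq with ⟨rfl, rfl⟩ | ⟨hb', hbj', rfl⟩ | ⟨rfl, -, hc', hn'⟩
        · exact ⟨rfl, rfl⟩
        · exact (hrootmatch _ hb' hbj' T h1 h2 h3 h4).elim
        · obtain rfl := h3.antisymm h4
          exact (hrootsing _ h1 h2 hc' hn').elim
        · exact (hrootmatch _ hb hbj T h3 h4 h1 h2).elim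
        · have : u = u' := by
            have e1 := hcardB _ hb
            have e2 := hcardB _ hb'
            have e3 := hcardC _ hb
            have e4 := hcardC _ hb'
            rcases hbetween _ hb T h1 h2 with e | e <;>
              rcases hbetween _ hb' T h3 h4 with e' | e'
            · exact e.symm.trans e'
            · rw [← e] at e1
              rw [← e'] at e4
              omega
            · rw [← e] at e3
              rw [← e'] at e2
              omega
            · exact hinj hb hb' (e.symm.trans e')
          exact ⟨this, this ▸ rfl⟩
        · obtain rfl := h3.antisymm h4
          exact (hmatchsing _ hb _ h1 h2 hc' hn').elim
        · obtain rfl := h1.antisymm h2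
          exact (hrootsing _ h3 h4 hc hn).elim
        · obtain rfl := h1.antisymm h2
          exact (hmatchsing _ hb' _ h3 h4 hc hn).elim
        · have := (h1.antisymm h2).trans (h3.antisymm h4).symm
          exact ⟨this, this⟩ }
  refine ⟨pt, ?_⟩
  refine le_csInf ⟨_, ({0}, {0, i, j}), (hS _).2 (Or.inl rfl), rfl⟩ ?_
  rintro k ⟨p, hp, rfl⟩
  rcases (hS p).1 hp with rfl | ⟨h1, -, h2⟩ | ⟨h1, -, h2, -⟩
  · exact ((hC _).1 hcC).1.ge
  · rw [h2, hcardC _ h1]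
  · rwa [h1]

theorem SqfPartition.sdepth_le {n : ℕ} {P : Set (Finset (Fin n))} (pt : SqfPartition n P) :
    pt.sdepth ≤ n := by
  rcases pt.intervals.eq_empty_or_nonempty with h | ⟨p, hp⟩
  · simp [SqfPartition.sdepth, h]
  · have : pt.sdepth ≤ p.2.card := Nat.sInf_le ⟨p, hp, rfl⟩
    refine this.trans ?_
    simpa using Finset.card_le_univ p.2

theorem SqfPartition.sdepth_le_stanleyDepth {K : Type*} [Field K] {n : ℕ}
    {I J : Ideal (MvPolynomial (Fin n) K)} (pt : SqfPartition n (sqfPoset K n I J)) :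
    pt.sdepth ≤ stanleyDepth K n I J := by
  refine le_csSup ⟨n, ?_⟩ ⟨pt, rfl⟩
  rintro k ⟨pt', rfl⟩
  exact pt'.sdepth_le

/-- **Theorem 1.10.** -/
theorem stmt0 (n : ℕ) [NeZero n] (K : Type*) [Field K]
    (I J : Ideal (MvPolynomial (Fin n) K))
    (E : Set (Finset (Fin n))) (hE : E.Nonempty)
    (hEdeg : ∀ T ∈ E, T.card = 2 ∧ (0 : Fin n) ∉ T)
    (hI : I = Ideal.span ({X (0 : Fin n)} ∪ sqf K n '' E))
    (hJI : J < I)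
    (hJ : ∃ G : Set (Finset (Fin n)), (∀ T ∈ G, 2 ≤ T.card) ∧
      J = Ideal.span (sqf K n '' G))
    (hsd : stanleyDepth K n I J = 2)
    (B C E' D : Set (Finset (Fin n)))
    (hB : B = degSet K n I J 2)
    (hC : C = degSet K n I J 3)
    (hE' : E' = {T ∈ E | insert (0 : Fin n) T ∈ C})
    (hD : D = {T ∈ C | sqf K n T ∉ Ideal.span ({X (0 : Fin n)} ∪ sqf K n '' E')})
    (hcond : (E \ E').ncard ≤ D.ncard ∨
      (D.ncard < (E \ E').ncard ∧ B.ncard ≠ C.ncard + 1)) :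
    mdepth K n I J ≤ 2 := by
  classical
  obtain ⟨G, hG, rfl⟩ := hJ
  have hIA : I = Ideal.span (sqf K n '' ({{0}} ∪ E)) := by
    rw [hI, Set.image_union, Set.image_singleton]
    simp [sqf]
  clear hI
  subst hIA
  set A : Set (Finset (Fin n)) := {{0}} ∪ E with hAdef
  have hA0 : {0} ∈ A := Or.inl rfl
  have hA : ∀ T ∈ A, T = {0} ∨ T.card = 2 := by
    rintro T (h | h)
    · exact Or.inl h
    · exact Or.inr (hEdeg T h).1
  have hAe : ∅ ∉ A := fun h => by
    rcases hA _ h with h | h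
    · exact Finset.singleton_ne_empty _ h.symm
    · simp at h
  by_contra hdepth
  have hex : KoszulTwoExact (Ideal.span (sqf K n '' A)) (Ideal.span (sqf K n '' G)) := by
    by_contra hno
    refine hdepth ?_
    refine csSup_le' ?_
    rintro k ⟨rs, rfl, hrs, hreg⟩
    by_contra! hlen
    exact hno (koszulTwoExact_of_isRegular hlen hrs hreg)
  have hmemI : ∀ T : Finset (Fin n), 0 ∈ T → sqf K n T ∈ Ideal.span (sqf K n '' A) :=
    fun T hT => sqf_mem_span_iff.2 ⟨_, hA0, by simpa using hT⟩
  have hpair : ∀ q : Fin n, q ≠ 0 → sqf K n {0, q} ∉ Ideal.span (sqf K n '' G) → {0, q} ∈ B := by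
    intro q hq h
    rw [hB]
    exact ⟨Finset.card_pair hq.symm, hmemI _ (by simp), h⟩
  obtain ⟨x, hx0⟩ : ∃ x : Fin n, x ≠ 0 := by
    obtain ⟨T, hT⟩ := hE
    obtain ⟨h2, h0⟩ := hEdeg T hT
    obtain ⟨x, hx⟩ := Finset.card_pos.1 (by omega : 0 < T.card)
    exact ⟨x, fun h => h0 (h ▸ hx)⟩
  obtain ⟨i, hi0, -, hi⟩ := exists_pair_of_koszulTwoExact hA0 hAe hG hex hx0
  obtain ⟨k, hk0, hki, hk⟩ := exists_pair_of_koszulTwoExact hA0 hAe hG hex hi0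
  obtain ⟨j, μ, hj, hji, hμj, hinj, hμ⟩ := exists_matching_of_cocycle (K := K) (B := B) (C := C)
    (fun b hb => by rw [hB] at hb; exact hb.1) (fun c hc => by rw [hC] at hc; exact hc.1)
    (fun c hc h0 q hq hq0 => hpair q hq0 fun h => by
      rw [hC] at hc
      obtain ⟨g, hg, hgq⟩ := sqf_mem_span_iff.1 h
      exact hc.2.2 (sqf_mem_span_iff.2 ⟨g, hg, hgq.trans (by
        intro y hy
        simp only [Finset.mem_insert, Finset.mem_singleton] at hy
        rcases hy with rfl | rfl <;> assumption)⟩))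
    (cocycle_of_koszulTwoExact hA hex hB hC) (hpair i hi0 hi) (hpair k hk0 hk) hki hk0
  obtain ⟨pt, hpt⟩ := exists_sqfPartition_of_matching
    (P := sqfPoset K n (Ideal.span (sqf K n '' A)) (Ideal.span (sqf K n '' G))) (B := B) (C := C)
    (by
      intro T hT
      obtain ⟨g, hg, hgT⟩ := sqf_mem_span_iff.1 hT.1
      have hle := Finset.card_le_card hgT
      rcases hA g hg with rfl | h
      · by_cases hc : 2 ≤ T.card
        · exact Or.inr hc
        · exact Or.inl (Finset.eq_of_subset_of_card_le hgT (by simp; omega)).symm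
      · exact Or.inr (h ▸ hle))
    ⟨hmemI _ (by simp), fun h => by
      obtain ⟨g, hg, hgT⟩ := sqf_mem_span_iff.1 h
      have := (hG g hg).trans (Finset.card_le_card hgT)
      simp at this⟩
    (fun T => by rw [hB]; rfl) (fun T => by rw [hC]; rfl) (hpair i hi0 hi) hj hji hμj hinj hμ
  have := hpt.trans pt.sdepth_le_stanleyDepth
  omega
end

section
/- Let K be a field, S = K[x_1,…,x_n], let I ⊆ S be the ideal generated by the variables x_1,…,x_r together with a nonempty set E of squarefree monomials of degree 2 in the variables x_{r+1},…,x_n, and let J ⊂ I be a squarefree monomial ideal generated in degrees ≥ 2 with sdepth_S I/J = 2. Let B be the set of squarefree monomials of degree 2 in I \ J, let x_1x_t ∈ B for some r < t ≤ n, let I' = (x_2,…,x_r) + (B \ {x_1x_t}), J' = J ∩ I', and let 𝒫 be a partition of P_{I'\J'} with sdepth 𝒫 = 3. Assume every squarefree monomial u ∈ S of degree 2 with u ∉ I satisfies x_1·u ∈ J. Then for any monomial a ∈ B with a divisible by x_t, a ∉ (x_2,…,x_r), a ≠ x_1x_t, and x_1·a ∉ J, the interval [a, x_1·a] belongs to 𝒫.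 -/
open MvPolynomial

theorem sqf_mul_sdiff (K : Type*) [Field K] {n : ℕ} {T U : Finset (Fin n)} (h : T ⊆ U) :
    sqf K n (U \ T) * sqf K n T = sqf K n U :=
  Finset.prod_sdiff h

theorem sqf_mem_of_subset {K : Type*} [Field K] {n : ℕ} {L : Ideal (MvPolynomial (Fin n) K)}
    {T U : Finset (Fin n)} (h : T ⊆ U) (hT : sqf K n T ∈ L) : sqf K n U ∈ L := by
  rw [← sqf_mul_sdiff K h]
  exact L.mul_mem_left _ hT

theorem sum_single_one_apply {n : ℕ} (T : Finset (Fin n)) (i : Fin n) :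
    (∑ j ∈ T, Finsupp.single j 1 : Fin n →₀ ℕ) i = if i ∈ T then 1 else 0 := by
  simp [Finsupp.finsetSum_apply, Finsupp.single_apply]

theorem sqf_mem_span_X_union_iff {K : Type*} [Field K] {n : ℕ} {V : Set (Fin n)}
    {G : Set (Finset (Fin n))} {T : Finset (Fin n)} :
    sqf K n T ∈ Ideal.span ((X '' V) ∪ sqf K n '' G) ↔
      (∃ i ∈ V, i ∈ T) ∨ ∃ g ∈ G, g ⊆ T := by
  have hX : (X '' V : Set (MvPolynomial (Fin n) K)) = sqf K n '' ((fun i => {i}) '' V) := by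
    rw [Set.image_image]
    exact Set.image_congr fun i _ => by simp [sqf]
  rw [hX, ← Set.image_union, sqf_mem_span_iff]
  constructor
  · rintro ⟨g, ⟨i, hi, rfl⟩ | hg, hgT⟩
    · exact Or.inl ⟨i, hi, by simpa using hgT⟩
    · exact Or.inr ⟨g, hg, hgT⟩
  · rintro (⟨i, hi, hiT⟩ | ⟨g, hg, hgT⟩)
    · exact ⟨{i}, Or.inl ⟨i, hi, rfl⟩, by simpa using hiT⟩
    · exact ⟨g, Or.inr hg, hgT⟩

/-- A partition with all upper ends of degree at least `d` bounds the Stanley depth below. -/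
theorem le_stanleyDepth {K : Type*} [Field K] {n : ℕ} {I J : Ideal (MvPolynomial (Fin n) K)}
    (pt : SqfPartition n (sqfPoset K n I J)) (hne : pt.intervals.Nonempty) {d : ℕ}
    (hd : ∀ p ∈ pt.intervals, d ≤ p.2.card) : d ≤ stanleyDepth K n I J := by
  have hpt : d ≤ pt.sdepth := by
    obtain ⟨p, hp⟩ := hne
    obtain ⟨q, hq, hqc⟩ := Nat.sInf_mem (s := {k | ∃ p ∈ pt.intervals, p.2.card = k})
      ⟨_, p, hp, rfl⟩
    exact (hd q hq).trans hqc.le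
  have hbdd : BddAbove {k | ∃ pt : SqfPartition n (sqfPoset K n I J), pt.sdepth = k} := by
    refine ⟨n, ?_⟩
    rintro k ⟨qt, rfl⟩
    by_cases hq : qt.intervals.Nonempty
    · obtain ⟨q, hq⟩ := hq
      have hle : qt.sdepth ≤ q.2.card := Nat.sInf_le ⟨q, hq, rfl⟩
      exact hle.trans (card_finset_fin_le q.2)
    · rw [Finset.not_nonempty_iff_eq_empty] at hq
      simp [SqfPartition.sdepth, hq]
  exact hpt.trans (le_csSup hbdd ⟨pt, rfl⟩)

/-- Let `P` arise from a convex set `P'` by adding sets between `{z}` and `insert z a`.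
If `[a, insert z a]` is not an interval of a partition of `P'`, then shrinking the intervals that
start below `insert z a` makes room for `[{z}, insert z a]`. -/
theorem SqfPartition.exists_extension {n : ℕ} {P P' : Set (Finset (Fin n))}
    (pt : SqfPartition n P') (hd : ∀ p ∈ pt.intervals, 3 ≤ p.2.card)
    (hconv : ∀ u ∈ P', ∀ v ∈ P', ∀ T, u ⊆ T → T ⊆ v → T ∈ P')
    {z : Fin n} {a : Finset (Fin n)} (hza : z ∉ a) (hac : a.card = 2) (ha : a ∈ P')
    (hlow : ∀ T ∈ P', T ⊆ insert z a → 2 ≤ T.card ∧ (z ∈ T ∨ T = a))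
    (hsub : P' ⊆ P) (hP : ∀ T ∈ P, T ∈ P' ∨ z ∈ T ∧ T ⊆ insert z a)
    (hz : {z} ∈ P) (hA : insert z a ∈ P) (hnot : (a, insert z a) ∉ pt.intervals) :
    ∃ qt : SqfPartition n P, qt.intervals.Nonempty ∧ ∀ p ∈ qt.intervals, 3 ≤ p.2.card := by
  classical
  obtain ⟨⟨u, v⟩, hp, hua, hav⟩ := pt.covers a ha
  simp only at hua hav
  have hu : u = a := by
    rcases (hlow u (pt.ends _ hp).1 (hua.trans (Finset.subset_insert z a))).2 with h | h
    · exact absurd (hua h) hza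
    · exact h
  subst hu
  obtain ⟨k, hkv, hkA⟩ : ∃ k ∈ v, k ∉ insert z u := by
    by_contra! h
    have hv : v = insert z u := Finset.eq_of_subset_of_card_le h (by
      rw [Finset.card_insert_of_notMem hza, hac]
      exact hd _ hp)
    exact hnot (hv ▸ hp)
  have hkz : z ≠ k := fun h => hkA (by simp [h])
  have hku : k ∉ u := fun h => hkA (by simp [h])
  have hkuv : insert k u ⊆ v := Finset.insert_subset hkv hav
  have hkP : insert k u ∈ P' :=
    hconv u ha v (pt.ends _ hp).2 _ (Finset.subset_insert k u) hkuv
  let Q : Finset (Fin n) × Finset (Fin n) → Prop := fun q =>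
    (q ∈ pt.intervals ∧ ¬ q.1 ⊆ insert z u) ∨ q = ({z}, insert z u) ∨ q = (u, insert k u) ∨
      (q.1 = q.2 ∧ q.1 ∈ P' ∧ ¬ q.1 ⊆ insert z u ∧ q.1 ≠ insert k u ∧
        ∃ p ∈ pt.intervals, p.1 ⊆ insert z u ∧ p.1 ⊆ q.1 ∧ q.1 ⊆ p.2)
  have hdisj : ∀ p q, Q p → Q q → ∀ T : Finset (Fin n),
      p.1 ⊆ T → T ⊆ p.2 → q.1 ⊆ T → T ⊆ q.2 → p = q := by
    have hpair : ∀ T, u ⊆ T → T ⊆ insert k u → T = u ∨ T = insert k u := by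
      intro T h1 h2
      by_cases hk : k ∈ T
      · exact Or.inr (h2.antisymm (Finset.insert_subset hk h1))
      · exact Or.inl (((Finset.subset_insert_iff_of_notMem hk).1 h2).antisymm h1)
    have h12 : ∀ p ∈ pt.intervals, ¬ p.1 ⊆ insert z u → ∀ T, p.1 ⊆ T → T ⊆ p.2 →
        ∀ q ∈ pt.intervals, q.1 ⊆ insert z u → q.1 ⊆ T → T ⊆ q.2 → False := by
      intro p hp hpl T h1 h2 q hq hql h3 h4
      exact hpl (pt.disj p hp q hq T h1 h2 h3 h4 ▸ hql)
    rintro ⟨p1, p2⟩ ⟨q1, q2⟩ hpQ hqQ T h1 h2 h3 h4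
    simp only [Q, Prod.mk.injEq] at hpQ hqQ h1 h2 h3 h4
    have hz3 : {z} ⊆ T → T ⊆ insert k u → False := by
      intro h h'
      have := h' (h (Finset.mem_singleton_self z))
      simp [hkz, hza] at this
    rcases hpQ with ⟨hp', hpl⟩ | ⟨rfl, rfl⟩ | ⟨rfl, rfl⟩ |
        ⟨rfl, -, hpl, hpk, p', hp', hpl', h5, h6⟩ <;>
      rcases hqQ with ⟨hq', hql⟩ | ⟨rfl, rfl⟩ | ⟨rfl, rfl⟩ |
        ⟨rfl, -, hql, hqk, q', hq', hql', h7, h8⟩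
    · exact pt.disj _ hp' _ hq' T h1 h2 h3 h4
    · exact absurd (h1.trans h4) hpl
    · exact (h12 _ hp' hpl T h1 h2 _ hp (Finset.subset_insert z _) h3 (h4.trans hkuv)).elim
    · exact (h12 _ hp' hpl T h1 h2 _ hq' hql' (h7.trans h3) (h4.trans h8)).elim
    · exact absurd (h3.trans h2) hql
    · rfl
    · exact (hz3 h1 h4).elim
    · exact absurd (h3.trans h2) hql
    · exact (h12 _ hq' hql T h3 h4 _ hp (Finset.subset_insert z _) h1 (h2.trans hkuv)).elim
    · exact (hz3 h3 h2).elim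
    · rfl
    · obtain rfl := h3.antisymm h4
      rcases hpair _ h1 h2 with rfl | rfl
      · exact absurd (Finset.subset_insert z _) hql
      · exact absurd rfl hqk
    · exact (h12 _ hq' hql T h3 h4 _ hp' hpl' (h5.trans h1) (h2.trans h6)).elim
    · exact absurd (h1.trans h4) hpl
    · obtain rfl := h1.antisymm h2
      rcases hpair _ h3 h4 with rfl | rfl
      · exact absurd (Finset.subset_insert z _) hpl
      · exact absurd rfl hpk
    · rw [h1.antisymm h2, h3.antisymm h4]
  refine ⟨⟨Finset.univ.filter Q, ?_, ?_, ?_, ?_⟩, ⟨({z}, insert z u), ?_⟩, ?_⟩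
  · intro q hq
    rcases (Finset.mem_filter.1 hq).2 with ⟨h, -⟩ | rfl | rfl | ⟨h, -⟩
    · exact pt.le q h
    · simp
    · exact Finset.subset_insert k u
    · exact h.le
  · intro q hq
    rcases (Finset.mem_filter.1 hq).2 with ⟨h, -⟩ | rfl | rfl | ⟨h, h', -⟩
    · exact ⟨hsub (pt.ends q h).1, hsub (pt.ends q h).2⟩
    · exact ⟨hz, hA⟩
    · exact ⟨hsub ha, hsub hkP⟩
    · exact ⟨hsub h', hsub (h ▸ h')⟩
  · intro T hT
    simp only [Finset.mem_filter, Finset.mem_univ, true_and]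
    by_cases hTA : T ⊆ insert z u
    · have hT' : z ∈ T ∨ T = u := (hP T hT).elim (fun h => (hlow T h hTA).2) fun h => Or.inl h.1
      rcases hT' with h | rfl
      · exact ⟨({z}, insert z u), Or.inr (Or.inl rfl), by simpa using h, hTA⟩
      · exact ⟨(T, insert k T), Or.inr (Or.inr (Or.inl rfl)), subset_rfl,
          Finset.subset_insert k T⟩
    · have hT' : T ∈ P' := (hP T hT).resolve_right fun h => hTA h.2
      obtain ⟨p, hp', h1, h2⟩ := pt.covers T hT'
      by_cases hpl : p.1 ⊆ insert z u
      · by_cases hTk : T = insert k u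
        · exact ⟨(u, insert k u), Or.inr (Or.inr (Or.inl rfl)), by simp [hTk], by simp [hTk]⟩
        · exact ⟨(T, T), Or.inr (Or.inr (Or.inr ⟨rfl, hT', hTA, hTk, p, hp', hpl, h1, h2⟩)),
            subset_rfl, subset_rfl⟩
      · exact ⟨p, Or.inl ⟨hp', hpl⟩, h1, h2⟩
  · intro p hp q hq
    exact hdisj p q (Finset.mem_filter.1 hp).2 (Finset.mem_filter.1 hq).2
  · exact Finset.mem_filter.2 ⟨Finset.mem_univ _, Or.inr (Or.inl rfl)⟩
  · intro q hq
    rcases (Finset.mem_filter.1 hq).2 with ⟨h, -⟩ | rfl | rfl | ⟨h, h', h1, -, p, hp', h2, h3, -⟩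
    · exact hd q h
    · simp [Finset.card_insert_of_notMem hza, hac]
    · simp [Finset.card_insert_of_notMem hku, hac]
    · rw [← h]
      have hlt : p.1 ⊂ q.1 := h3.ssubset_of_ne fun he => h1 (he ▸ h2)
      exact Nat.succ_le_of_lt
        ((hlow p.1 (pt.ends p hp').1 h2).1.trans_lt (Finset.card_lt_card hlt))

/-- **Lemma 1.7 (1).** -/
theorem stmt3 (n : ℕ) [NeZero n] (K : Type*) [Field K]
    (r : ℕ) (hr1 : 1 ≤ r) (hrn : r ≤ n)
    (I J : Ideal (MvPolynomial (Fin n) K))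
    (E : Set (Finset (Fin n))) (hE : E.Nonempty)
    (hEdeg : ∀ T ∈ E, T.card = 2 ∧ ∀ i ∈ T, r ≤ (i : ℕ))
    (hI : I = Ideal.span ((X '' {i : Fin n | (i : ℕ) < r}) ∪ sqf K n '' E))
    (hJI : J < I)
    (hJ : ∃ G : Set (Finset (Fin n)), (∀ T ∈ G, 2 ≤ T.card) ∧
      J = Ideal.span (sqf K n '' G))
    (hsd : stanleyDepth K n I J = 2)
    (t : Fin n) (ht : r ≤ (t : ℕ))
    (hxt : ({0, t} : Finset (Fin n)) ∈ degSet K n I J 2)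
    (I' J' : Ideal (MvPolynomial (Fin n) K))
    (hI' : I' = Ideal.span ((X '' {i : Fin n | 0 < (i : ℕ) ∧ (i : ℕ) < r}) ∪
      sqf K n '' (degSet K n I J 2 \ {({0, t} : Finset (Fin n))})))
    (hJ' : J' = J ⊓ I')
    (pt : SqfPartition n (sqfPoset K n I' J'))
    (hpt : pt.sdepth = 3)
    (hout : ∀ T : Finset (Fin n), T.card = 2 → sqf K n T ∉ I →
      X (0 : Fin n) * sqf K n T ∈ J) :
    ∀ a : Finset (Fin n), a ∈ degSet K n I J 2 → t ∈ a →
      sqf K n a ∉ Ideal.span (X '' {i : Fin n | 0 < (i : ℕ) ∧ (i : ℕ) < r}) →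
      a ≠ {0, t} → X (0 : Fin n) * sqf K n a ∉ J →
      (a, insert (0 : Fin n) a) ∈ pt.intervals := by
  intro a ha hta haV hane haJ
  have h0r : ((0 : Fin n) : ℕ) < r := by simpa using Nat.lt_of_succ_le hr1
  have ht0 : (0 : Fin n) ≠ t := by
    rintro rfl
    omega
  have hza : (0 : Fin n) ∉ a := fun h0 => hane
    (Finset.eq_of_subset_of_card_le (Finset.insert_subset h0 (Finset.singleton_subset_iff.2 hta))
      (by rw [ha.1, Finset.card_pair ht0])).symm
  have haV' : ∀ i ∈ a, ¬ (0 < (i : ℕ) ∧ (i : ℕ) < r) := by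
    intro i hi hir
    refine haV (sqf_mem_of_subset (Finset.singleton_subset_iff.2 hi)
      (Ideal.subset_span ⟨i, hir, ?_⟩))
    simp [sqf]
  have hAV : ∀ i ∈ insert 0 a, ¬ (0 < (i : ℕ) ∧ (i : ℕ) < r) := by
    intro i hi
    rcases Finset.mem_insert.1 hi with rfl | hi
    · simp
    · exact haV' i hi
  have hAJ : sqf K n (insert 0 a) ∉ J := by
    rwa [sqf, Finset.prod_insert hza]
  have hmemI' : ∀ T, sqf K n T ∈ I' ↔ (∃ i : Fin n, (0 < (i : ℕ) ∧ (i : ℕ) < r) ∧ i ∈ T) ∨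
      ∃ g, (g ∈ degSet K n I J 2 ∧ g ≠ {0, t}) ∧ g ⊆ T := by
    intro T
    rw [hI', sqf_mem_span_X_union_iff]
    rfl
  have hmemI : ∀ T, sqf K n T ∈ I ↔ (∃ i : Fin n, (i : ℕ) < r ∧ i ∈ T) ∨ ∃ g ∈ E, g ⊆ T := by
    intro T
    rw [hI, sqf_mem_span_X_union_iff]
    rfl
  have hsub : sqfPoset K n I' J' ⊆ sqfPoset K n I J := by
    rintro T ⟨hT, hTJ⟩
    refine ⟨?_, fun h => hTJ (hJ' ▸ ⟨h, hT⟩)⟩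
    rcases (hmemI' T).1 hT with ⟨i, hi, hiT⟩ | ⟨g, hg, hgT⟩
    · exact (hmemI T).2 (Or.inl ⟨i, hi.2, hiT⟩)
    · exact sqf_mem_of_subset hgT hg.1.2.1
  have hJ'J : ∀ T, sqf K n T ∉ J → sqf K n T ∉ J' := fun T h h' => h (hJ' ▸ h' : _ ∈ J ⊓ I').1
  by_contra hnot
  obtain ⟨qt, hne, hq⟩ := pt.exists_extension (P := sqfPoset K n I J) (z := 0) (a := a)
    (fun p hp => hpt ▸ Nat.sInf_le ⟨p, hp, rfl⟩)
    (fun u hu v hv T huT hTv =>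
      ⟨sqf_mem_of_subset huT hu.1, fun h => hv.2 (sqf_mem_of_subset hTv h)⟩)
    hza ha.1 ⟨(hmemI' a).2 (Or.inr ⟨a, ⟨ha, hane⟩, subset_rfl⟩), hJ'J a ha.2.2⟩
    (by
      rintro T ⟨hT, -⟩ hTA
      rcases (hmemI' T).1 hT with ⟨i, hi, hiT⟩ | ⟨g, hg, hgT⟩
      · exact absurd hi (hAV i (hTA hiT))
      · have hc : 2 ≤ T.card := hg.1.1 ▸ Finset.card_le_card hgT
        refine ⟨hc, or_iff_not_imp_left.2 fun h0 => ?_⟩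
        exact Finset.eq_of_subset_of_card_le ((Finset.subset_insert_iff_of_notMem h0).1 hTA)
          (ha.1 ▸ hc))
    hsub
    (by
      rintro T ⟨hT, hTJ⟩
      refine or_iff_not_imp_left.2 fun hT' => ?_
      have hTI' : sqf K n T ∉ I' := fun h => hT' ⟨h, hJ'J T hTJ⟩
      rw [hmemI'] at hTI'
      push Not at hTI'
      obtain ⟨hTV, hTB⟩ := hTI'
      have hB : ∀ g ⊆ T, g.card = 2 → sqf K n g ∈ I → g = {0, t} := by
        intro g hgT hgc hgI
        by_contra hg
        exact hTB g ⟨⟨hgc, hgI, fun h => hTJ (sqf_mem_of_subset hgT h)⟩, hg⟩ hgT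
      have h0T : (0 : Fin n) ∈ T := by
        rcases (hmemI T).1 hT with ⟨i, hi, hiT⟩ | ⟨g, hg, hgT⟩
        · have hi0 : ¬ 0 < (i : ℕ) := fun h => hTV i ⟨h, hi⟩ hiT
          have : i = 0 := Fin.ext (by simpa using hi0)
          exact this ▸ hiT
        · have h := hB g hgT (hEdeg g hg).1 ((hmemI g).2 (Or.inr ⟨g, hg, subset_rfl⟩))
          exact hgT (by simp [h])
      refine ⟨h0T, fun j hj => ?_⟩
      by_cases hj0 : j = 0
      · simp [hj0]
      · have h := hB {0, j} (Finset.insert_subset h0T (Finset.singleton_subset_iff.2 hj))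
          (Finset.card_pair (Ne.symm hj0)) ((hmemI _).2 (Or.inl ⟨0, h0r, by simp⟩))
        have hjt : j ∈ ({0, t} : Finset (Fin n)) := h ▸ by simp
        have : j = t := by simpa [hj0] using hjt
        exact Finset.mem_insert_of_mem (this ▸ hta))
    ⟨(hmemI _).2 (Or.inl ⟨0, h0r, by simp⟩),
      fun h => hxt.2.2 (sqf_mem_of_subset (by simp) h)⟩
    ⟨(hmemI _).2 (Or.inl ⟨0, h0r, by simp⟩), hAJ⟩ hnot
  have := le_stanleyDepth qt hne hq
  omega
end
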